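/- arXiv:2409.08614 — 6 statements merged into one kernel-verified Lean document; each statement's English description precedes it below -/
import Mathlib

section
/- Let F : [0,1] → ℝ be absolutely continuous with F(0) = 0 and F′ ∈ L²([0,1]), and suppose D(F) ≤ ε and ‖F′‖_{L²([0,1])} ≤ δ for some ε, δ > 0. Set γ = ε^{1/2} + ε^{1/4}·δ^{1/2}. Then |C_F| ≤ 2γ, sup_{t∈[0,1]} |F(t)| ≤ 4γ, and ‖F² − C_F²‖_{L²([0,1])} ≤ 6·ε^{1/2}·γ. -/
open MeasureTheory Real Filter Set

noncomputable section

/-- `D(F) = ∫₀¹ F² − (∫₀¹ F)²`, the variation of `F` on `[0,1]`. -/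
def Dvar (F : ℝ → ℝ) : ℝ :=
  (∫ s in (0:ℝ)..1, (F s) ^ 2) - (∫ s in (0:ℝ)..1, F s) ^ 2

/-- A weighted Cauchy–Schwarz estimate for the increments of the square of an absolutely continuous
function. -/
theorem abs_sq_sub_sq_le_integral {G f : ℝ → ℝ} {a b s t c : ℝ} (hc : 0 < c)
    (hG : AbsolutelyContinuousOnInterval G a b)
    (hGf : ∀ᵐ x, x ∈ uIcc a b → HasDerivAt G (f x) x)
    (hf : IntervalIntegrable (fun x => f x ^ 2) volume a b)
    (hs : s ∈ uIcc a b) (ht : t ∈ uIcc a b) :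
    |G t ^ 2 - G s ^ 2| ≤ |∫ x in a..b, (c * G x ^ 2 + c⁻¹ * f x ^ 2)| := by
  have hst : uIcc s t ⊆ uIcc a b := uIcc_subset_uIcc hs ht
  have hst' : uIoc s t ⊆ uIoc a b := by
    rcases mem_uIcc.1 hs with hs | hs <;> rcases mem_uIcc.1 ht with ht | ht <;>
      exact Ioc_subset_Ioc (by simp; grind) (by simp; grind)
  have hint : IntervalIntegrable (fun x => c * G x ^ 2 + c⁻¹ * f x ^ 2) volume a b :=
    ((hG.continuousOn.pow 2).intervalIntegrable.const_mul c).add (hf.const_mul c⁻¹)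
  have hftc := ((hG.mul hG).mono hst).integral_deriv_eq_sub
  have heq : G t ^ 2 - G s ^ 2 = ∫ x in s..t, deriv (G * G) x := by
    rw [hftc]; simp only [Pi.mul_apply]; ring
  rw [heq]
  refine (intervalIntegral.norm_integral_le_abs_of_norm_le (f := deriv (G * G)) ?_
    (hint.mono_set hst)).trans (intervalIntegral.abs_integral_mono_interval hst'
      (Eventually.of_forall fun x => ?_) hint)
  · rw [ae_restrict_iff' measurableSet_uIoc]
    filter_upwards [hGf] with x hx hxst
    have hd := hx (hst (uIoc_subset_uIcc hxst))
    rw [(hd.mul hd).deriv, Real.norm_eq_abs, abs_le]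
    have h₁ : 0 ≤ c⁻¹ * (c * G x + f x) ^ 2 := by positivity
    have h₂ : 0 ≤ c⁻¹ * (c * G x - f x) ^ 2 := by positivity
    have h₃ : c⁻¹ * (c * G x + f x) ^ 2 = c * G x ^ 2 + c⁻¹ * f x ^ 2 + 2 * (G x * f x) := by
      field_simp; ring
    have h₄ : c⁻¹ * (c * G x - f x) ^ 2 = c * G x ^ 2 + c⁻¹ * f x ^ 2 - 2 * (G x * f x) := by
      field_simp; ring
    constructor <;> linarith
  · simp only [Pi.zero_apply]; positivity

theorem integral_sub_mean_sq {F : ℝ → ℝ} (hF : ContinuousOn F (uIcc 0 1)) :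
    ∫ s in (0:ℝ)..1, (F s - ∫ u in (0:ℝ)..1, F u) ^ 2 = Dvar F := by
  set C := ∫ u in (0:ℝ)..1, F u with hC
  have h : ∀ s, (F s - C) ^ 2 = F s ^ 2 - 2 * C * F s + C ^ 2 := fun s => by ring
  have h₁ : IntervalIntegrable (fun s => F s ^ 2) volume 0 1 := (hF.pow 2).intervalIntegrable
  have h₂ := hF.intervalIntegrable (μ := volume).const_mul (2 * C)
  simp_rw [h]
  rw [intervalIntegral.integral_add (h₁.sub h₂) (by simp), intervalIntegral.integral_sub h₁ h₂,
    intervalIntegral.integral_const_mul, ← hC, Dvar, ← hC]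
  simp
  ring

theorem exists_eq_integral_unitInterval {F : ℝ → ℝ} (hF : ContinuousOn F (uIcc 0 1)) :
    ∃ c ∈ uIcc (0:ℝ) 1, F c = ∫ s in (0:ℝ)..1, F s := by
  obtain ⟨c, hc, h⟩ := exists_eq_const_mul_intervalIntegral_of_nonneg (μ := volume)
    (g := fun _ => 1) hF (by simp) (by simp)
  exact ⟨c, hc, by simpa using h.symm⟩

/-- If `F` is absolutely continuous on `[0,1]` with `F(0) = 0` and derivative `f ∈ L²`,
`D(F) ≤ ε` and `‖f‖₂ ≤ δ`, then with `γ = ε^{1/2} + ε^{1/4} δ^{1/2}` one has `|C_F| ≤ 2γ`,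
`sup |F| ≤ 4γ` and `‖F² − C_F²‖₂ ≤ 6 ε^{1/2} γ`. -/
theorem variation_uniform_bounds (F f : ℝ → ℝ) (ε δ : ℝ) (hε : 0 < ε) (hδ : 0 < δ)
    (hF0 : F 0 = 0)
    (hint : ∀ t ∈ Icc (0:ℝ) 1, IntervalIntegrable f volume 0 t)
    (hAC : ∀ t ∈ Icc (0:ℝ) 1, F t = ∫ s in (0:ℝ)..t, f s)
    (hf2int : IntervalIntegrable (fun s => (f s) ^ 2) volume 0 1)
    (hfL2 : Real.sqrt (∫ s in (0:ℝ)..1, (f s) ^ 2) ≤ δ)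
    (hD : Dvar F ≤ ε) :
    |∫ s in (0:ℝ)..1, F s| ≤ 2 * (Real.sqrt ε + ε ^ ((1:ℝ)/4) * Real.sqrt δ) ∧
    (∀ t ∈ Icc (0:ℝ) 1, |F t| ≤ 4 * (Real.sqrt ε + ε ^ ((1:ℝ)/4) * Real.sqrt δ)) ∧
    Real.sqrt (∫ s in (0:ℝ)..1, ((F s) ^ 2 - (∫ u in (0:ℝ)..1, F u) ^ 2) ^ 2) ≤
      6 * Real.sqrt ε * (Real.sqrt ε + ε ^ ((1:ℝ)/4) * Real.sqrt δ) := by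
  set C := ∫ u in (0:ℝ)..1, F u with hC
  set γ := √ε + ε ^ ((1:ℝ)/4) * √δ with hγ
  have h01 : uIcc (0:ℝ) 1 = Icc 0 1 := uIcc_of_le zero_le_one
  have hf := hint 1 (by simp)
  have hP := hf.absolutelyContinuousOnInterval_intervalIntegral (c := 0) (by simp)
  have hFc : ContinuousOn F (uIcc 0 1) := hP.continuousOn.congr (by rwa [h01])
  have hsub : ContinuousOn (fun s => (F s - C) ^ 2) (uIcc 0 1) :=
    (hFc.sub continuousOn_const).pow 2
  have hDvar : ∫ s in (0:ℝ)..1, (F s - C) ^ 2 ≤ ε := (integral_sub_mean_sq hFc).trans_le hD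
  have hγ0 : 0 ≤ γ := by positivity
  have hsqε : √ε ^ 2 = ε := Real.sq_sqrt hε.le
  have hγsq : √ε * δ ≤ γ ^ 2 := by
    have h₁ : (ε ^ ((1:ℝ)/4)) ^ 2 = √ε := by
      rw [Real.sqrt_eq_rpow, ← Real.rpow_natCast, ← Real.rpow_mul hε.le]; norm_num
    calc √ε * δ = (ε ^ ((1:ℝ)/4) * √δ) ^ 2 := by rw [mul_pow, h₁, Real.sq_sqrt hδ.le]
      _ ≤ γ ^ 2 := by gcongr; exact le_add_of_nonneg_left (by positivity)
  have hfδ : ∫ s in (0:ℝ)..1, f s ^ 2 ≤ δ ^ 2 := (Real.sqrt_le_left hδ.le).1 hfL2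
  obtain ⟨t₀, ht₀, hFt₀⟩ := exists_eq_integral_unitInterval hFc
  have hdev : ∀ t ∈ Icc (0:ℝ) 1, |F t - C| ≤ 2 * γ := by
    intro t ht
    have hc : 0 < δ / √ε := by positivity
    have hG : AbsolutelyContinuousOnInterval (fun x => (∫ s in (0:ℝ)..x, f s) - C) 0 1 :=
      hP.fun_sub ((LipschitzWith.const C).lipschitzOnWith).absolutelyContinuousOnInterval
    have hGf : ∀ᵐ x, x ∈ uIcc (0:ℝ) 1 →
        HasDerivAt (fun x => (∫ s in (0:ℝ)..x, f s) - C) (f x) x := by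
      filter_upwards [hf.ae_hasDerivAt_integral] with x hx hx'
      exact (hx hx' 0 (by simp)).sub_const C
    have key := abs_sq_sub_sq_le_integral hc hG hGf hf2int ht₀ (h01 ▸ ht)
    have hcongr : ∫ x in (0:ℝ)..1, (δ / √ε * ((∫ s in (0:ℝ)..x, f s) - C) ^ 2
        + (δ / √ε)⁻¹ * f x ^ 2) = ∫ x in (0:ℝ)..1, (δ / √ε * (F x - C) ^ 2
        + (δ / √ε)⁻¹ * f x ^ 2) :=
      intervalIntegral.integral_congr fun x hx => by simp only [hAC x (h01 ▸ hx)]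
    rw [hcongr, ← hAC t ht, ← hAC t₀ (h01 ▸ ht₀), hFt₀, sub_self,
      intervalIntegral.integral_add
        (hsub.intervalIntegrable.const_mul _) (hf2int.const_mul _),
      intervalIntegral.integral_const_mul, intervalIntegral.integral_const_mul] at key
    have hD0 : 0 ≤ ∫ s in (0:ℝ)..1, (F s - C) ^ 2 :=
      intervalIntegral.integral_nonneg zero_le_one fun _ _ => sq_nonneg _
    have hf0 : 0 ≤ ∫ s in (0:ℝ)..1, f s ^ 2 :=
      intervalIntegral.integral_nonneg zero_le_one fun _ _ => sq_nonneg _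
    rw [zero_pow two_ne_zero, sub_zero, abs_of_nonneg (sq_nonneg _),
      abs_of_nonneg (by positivity)] at key
    refine abs_le_of_sq_le_sq ?_ (by positivity)
    calc (F t - C) ^ 2 ≤ δ / √ε * (∫ s in (0:ℝ)..1, (F s - C) ^ 2)
          + (δ / √ε)⁻¹ * ∫ s in (0:ℝ)..1, f s ^ 2 := key
      _ ≤ δ / √ε * √ε ^ 2 + (δ / √ε)⁻¹ * δ ^ 2 := by rw [hsqε]; gcongr
      _ = 2 * (√ε * δ) := by field_simp; ring
      _ ≤ (2 * γ) ^ 2 := by nlinarith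
  have hCγ : |C| ≤ 2 * γ := by simpa [hF0] using hdev 0 (by simp)
  have hFγ : ∀ t ∈ Icc (0:ℝ) 1, |F t| ≤ 4 * γ := fun t ht => by
    have := abs_add_le (F t - C) C
    rw [sub_add_cancel] at this
    linarith [hdev t ht]
  refine ⟨hCγ, hFγ, Real.sqrt_le_iff.2 ⟨by positivity, ?_⟩⟩
  calc ∫ s in (0:ℝ)..1, (F s ^ 2 - C ^ 2) ^ 2
      ≤ ∫ s in (0:ℝ)..1, (6 * γ) ^ 2 * (F s - C) ^ 2 := by
        refine intervalIntegral.integral_mono_on zero_le_one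
          (((hFc.pow 2).sub continuousOn_const).pow 2).intervalIntegrable
          (hsub.intervalIntegrable.const_mul _) fun s hs => ?_
        have h : (F s + C) ^ 2 ≤ (6 * γ) ^ 2 :=
          sq_le_sq.2 (by
            rw [abs_of_nonneg (by positivity : 0 ≤ 6 * γ)]
            linarith [abs_add_le (F s) C, hFγ s hs])
        calc (F s ^ 2 - C ^ 2) ^ 2 = (F s + C) ^ 2 * (F s - C) ^ 2 := by ring
          _ ≤ _ := by gcongr
    _ = (6 * γ) ^ 2 * ∫ s in (0:ℝ)..1, (F s - C) ^ 2 :=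
        intervalIntegral.integral_const_mul _ _
    _ ≤ (6 * γ) ^ 2 * √ε ^ 2 := by rw [hsqε]; gcongr
    _ = (6 * √ε * γ) ^ 2 := by ring
end
end

section
/- Let a ∈ L¹_loc([0,∞)) be complex-valued, let λ, μ ∈ ℂ, and let P(·,λ), P_*(·,λ) and P(·,μ), P_*(·,μ) be solutions of the Krein system with coefficient a. Then for every r ≥ 0 (Christoffel–Darboux formula): P(r,λ)·conj(P(r,μ)) − P_*(r,λ)·conj(P_*(r,μ)) = i(λ − conj(μ))·∫₀^r P(s,λ)·conj(P(s,μ)) ds. -/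
open MeasureTheory Real Filter Set

noncomputable section

/-- `IsKreinSol a z P Ps` : the pair `(P, Ps)` is the solution of the Krein system with
coefficient `a` at spectral parameter `z`, encoded by the equivalent integral equations
`P(r) = 1 + ∫₀^r (i z P(s) − conj(a(s)) P_*(s)) ds` and `P_*(r) = 1 − ∫₀^r a(s) P(s) ds`,
the integrands being locally integrable (this encodes local absolute continuity together
with the a.e. differential equations and the initial conditions). -/
def IsKreinSol (a : ℝ → ℂ) (z : ℂ) (P Ps : ℝ → ℂ) : Prop :=
  P 0 = 1 ∧ Ps 0 = 1 ∧
  ∀ r ≥ (0:ℝ),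
    IntervalIntegrable (fun s => Complex.I * z * P s - (starRingEnd ℂ) (a s) * Ps s) volume 0 r ∧
    IntervalIntegrable (fun s => a s * P s) volume 0 r ∧
    P r = 1 + ∫ s in (0:ℝ)..r, (Complex.I * z * P s - (starRingEnd ℂ) (a s) * Ps s) ∧
    Ps r = 1 + ∫ s in (0:ℝ)..r, (-(a s * P s))

lemma AbsolutelyContinuousOnInterval.congr {X : Type*} [PseudoMetricSpace X] {f g : ℝ → X}
    {a b : ℝ} (hf : AbsolutelyContinuousOnInterval f a b) (hfg : EqOn f g (uIcc a b)) :
    AbsolutelyContinuousOnInterval g a b := by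
  rw [absolutelyContinuousOnInterval_iff] at hf ⊢
  intro ε hε
  obtain ⟨δ, hδ, h⟩ := hf ε hε
  refine ⟨δ, hδ, fun E hE hlen => ?_⟩
  convert! h E hE hlen using 1
  refine Finset.sum_congr rfl fun i hi => ?_
  rw [hfg (hE.1 i hi).1, hfg (hE.1 i hi).2]

lemma IntervalIntegrable.absolutelyContinuousOnInterval_add_intervalIntegral {f : ℝ → ℂ}
    {a b : ℝ} (hf : IntervalIntegrable f volume a b) (c : ℂ) :
    AbsolutelyContinuousOnInterval (fun x => c + ∫ t in a..x, f t) a b := by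
  have const_ac (z : ℂ) : AbsolutelyContinuousOnInterval (fun _ => z) a b :=
    (LipschitzWith.const z).lipschitzOnWith.absolutelyContinuousOnInterval
  have hre := IntervalIntegrable.absolutelyContinuousOnInterval_intervalIntegral
    (c := a) (f := fun t => (f t).re) ⟨hf.1.re, hf.2.re⟩ left_mem_uIcc
  have him := IntervalIntegrable.absolutelyContinuousOnInterval_intervalIntegral
    (c := a) (f := fun t => (f t).im) ⟨hf.1.im, hf.2.im⟩ left_mem_uIcc
  have hcomb := (const_ac c).fun_add
    ((hre.fun_smul (const_ac 1)).fun_add (him.fun_smul (const_ac Complex.I)))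
  have heq : EqOn (fun x => c + ((∫ t in a..x, (f t).re) • (1 : ℂ) +
      (∫ t in a..x, (f t).im) • Complex.I)) (fun x => c + ∫ t in a..x, f t) (uIcc a b) := by
    intro x hx
    have hfx : IntervalIntegrable f volume a x := hf.mono_set (uIcc_subset_uIcc_left hx)
    have h1 := Complex.reCLM.intervalIntegral_comp_comm hfx
    have h2 := Complex.imCLM.intervalIntegral_comp_comm hfx
    simp only [Complex.reCLM_apply, Complex.imCLM_apply] at h1 h2
    simp only [h1, h2, Complex.real_smul, mul_one, Complex.re_add_im]
  exact hcomb.congr heq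

/-- The product rule, in integrated form, for two antiderivatives of integrable functions. -/
lemma integral_mul_antideriv_add_antideriv_mul {u v F G : ℝ → ℂ} {a b : ℝ}
    (hu : IntervalIntegrable u volume a b) (hv : IntervalIntegrable v volume a b)
    {c d : ℂ} (hF : ∀ x ∈ uIcc a b, F x = c + ∫ t in a..x, u t)
    (hG : ∀ x ∈ uIcc a b, G x = d + ∫ t in a..x, v t) :
    IntervalIntegrable (fun x => u x * G x + F x * v x) volume a b ∧
      ∫ x in a..b, (u x * G x + F x * v x) = F b * G b - F a * G a := by
  have hFac := (hu.absolutelyContinuousOnInterval_add_intervalIntegral c).congr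
    fun x hx => (hF x hx).symm
  have hGac := (hv.absolutelyContinuousOnInterval_add_intervalIntegral d).congr
    fun x hx => (hG x hx).symm
  have hint : IntervalIntegrable (fun x => u x * G x + F x * v x) volume a b :=
    (hu.mul_continuousOn hGac.continuousOn).add (hv.continuousOn_mul hFac.continuousOn)
  refine ⟨hint, ?_⟩
  have hac := (((hu.absolutelyContinuousOnInterval_add_intervalIntegral c).fun_smul
    (hv.absolutelyContinuousOnInterval_add_intervalIntegral d)).fun_sub
    (hint.absolutelyContinuousOnInterval_add_intervalIntegral 0))
  obtain ⟨C, hC⟩ := hac.const_of_ae_hasDerivAt_zero (by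
    filter_upwards [hu.ae_hasDerivAt_integral, hv.ae_hasDerivAt_integral,
      hint.ae_hasDerivAt_integral] with x hux hvx hx hxab
    have := (((hux hxab a left_mem_uIcc).const_add c).mul
      ((hvx hxab a left_mem_uIcc).const_add d)).sub
      ((hx hxab a left_mem_uIcc).const_add 0)
    convert! this using 1
    rw [hF x hxab, hG x hxab]
    ring)
  have ha := hC a left_mem_uIcc
  have hb := hC b right_mem_uIcc
  simp only [smul_eq_mul, ← hF b right_mem_uIcc, ← hG b right_mem_uIcc,
    intervalIntegral.integral_same, add_zero, zero_add, sub_zero] at ha hb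
  rw [hF a left_mem_uIcc, hG a left_mem_uIcc]
  simp only [intervalIntegral.integral_same, add_zero]
  linear_combination ha - hb

lemma IntervalIntegrable.conj {f : ℝ → ℂ} {a b : ℝ} (hf : IntervalIntegrable f volume a b) :
    IntervalIntegrable (fun x => (starRingEnd ℂ) (f x)) volume a b :=
  ⟨(Complex.conjCLE : ℂ →L[ℝ] ℂ).integrable_comp hf.1,
    (Complex.conjCLE : ℂ →L[ℝ] ℂ).integrable_comp hf.2⟩

/-- Christoffel–Darboux formula for Krein systems:
`P(r,λ) conj(P(r,μ)) − P_*(r,λ) conj(P_*(r,μ)) = i(λ − conj μ) ∫₀^r P(s,λ) conj(P(s,μ)) ds`. -/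
theorem krein_christoffel_darboux (a : ℝ → ℂ) (ha : LocallyIntegrableOn a (Ici (0:ℝ)) volume)
    (lam mu : ℂ) (P Ps Pm Psm : ℝ → ℂ)
    (hl : IsKreinSol a lam P Ps)
    (hm : IsKreinSol a mu Pm Psm) :
    ∀ r ≥ (0:ℝ),
      P r * (starRingEnd ℂ) (Pm r) - Ps r * (starRingEnd ℂ) (Psm r) =
        Complex.I * (lam - (starRingEnd ℂ) mu) * ∫ s in (0:ℝ)..r, P s * (starRingEnd ℂ) (Pm s) := by
  intro r hr
  obtain ⟨hP0, hPs0, hl⟩ := hl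
  obtain ⟨hPm0, hPsm0, hm⟩ := hm
  obtain ⟨hu, hw, -, -⟩ := hl r hr
  obtain ⟨hum, hwm, -, -⟩ := hm r hr
  have hnonneg {x : ℝ} (hx : x ∈ uIcc 0 r) : 0 ≤ x := by
    rw [uIcc_of_le hr] at hx
    exact hx.1
  obtain ⟨hi₁, h₁⟩ := integral_mul_antideriv_add_antideriv_mul (F := P)
    (G := fun x => (starRingEnd ℂ) (Pm x)) (c := 1) (d := 1) hu hum.conj
    (fun x hx => (hl x (hnonneg hx)).2.2.1)
    (fun x hx => by
      rw [intervalIntegral.intervalIntegral_conj, (hm x (hnonneg hx)).2.2.1, map_add, map_one])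
  obtain ⟨hi₂, h₂⟩ := integral_mul_antideriv_add_antideriv_mul (F := Ps)
    (G := fun x => (starRingEnd ℂ) (Psm x)) (c := 1) (d := 1) hw.neg hwm.neg.conj
    (fun x hx => (hl x (hnonneg hx)).2.2.2)
    (fun x hx => by
      rw [(hm x (hnonneg hx)).2.2.2, map_add, map_one, ← intervalIntegral.intervalIntegral_conj]
      rfl)
  have hsub := intervalIntegral.integral_sub hi₁ hi₂
  rw [h₁, h₂, hP0, hPs0, hPm0, hPsm0] at hsub
  rw [← intervalIntegral.integral_const_mul]
  trans P r * (starRingEnd ℂ) (Pm r) - 1 * (starRingEnd ℂ) 1 -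
      (Ps r * (starRingEnd ℂ) (Psm r) - 1 * (starRingEnd ℂ) 1)
  · ring
  · rw [← hsub]
    congr 1
    ext s
    simp only [Pi.neg_apply, map_sub, map_mul, map_neg, Complex.conj_I, Complex.conj_conj]
    ring
end
end

section
/- Let α > 1 and let f : [0,∞) → ℝ be a measurable function such that |f(r)| ≤ C₀·exp(−r^α/c₁) for all r ≥ 0, for some constants C₀, c₁ > 0. Define g(x) = Σ_{n≥0} f(n)·e^{xn}. Then g(x) is bounded for x ≤ 0, and there exist constants C, c > 0 such that |g(x)| ≤ C·exp(c·x^{α*}) for all x > 0, where α* = α/(α−1). -/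
open MeasureTheory Real Filter Set

noncomputable section

/-- Young's inequality with a free weight on the first factor. -/
lemma exists_mul_le_weighted_rpow_add {p ε : ℝ} (hp : 1 < p) (hε : 0 < ε) :
    ∃ c > (0 : ℝ), ∀ x ≥ (0 : ℝ), ∀ r ≥ (0 : ℝ),
      x * r ≤ ε * r ^ p + c * x ^ (p / (p - 1)) := by
  have hp0 : 0 < p := by linarith
  have hq : 0 < p / (p - 1) := div_pos hp0 (by linarith)
  obtain ⟨s, hs, hsp⟩ : ∃ s > (0 : ℝ), s ^ p = ε * p :=
    ⟨(ε * p) ^ p⁻¹, by positivity, Real.rpow_inv_rpow (by positivity) hp0.ne'⟩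
  refine ⟨(s ^ (p / (p - 1)) * (p / (p - 1)))⁻¹, by positivity, fun x hx r hr => ?_⟩
  have young := Real.young_inequality_of_nonneg (mul_nonneg hs.le hr) (div_nonneg hx hs.le)
    (Real.HolderConjugate.conjExponent hp)
  rw [Real.conjExponent, Real.mul_rpow hs.le hr, Real.div_rpow hx hs.le, hsp] at young
  calc x * r = s * r * (x / s) := by field_simp
    _ ≤ _ := young
    _ = _ := by
      rw [mul_inv, div_div, div_eq_mul_inv (x ^ _), mul_inv, mul_comm (x ^ _)]
      congr 1
      field_simp

lemma summable_exp_neg_natCast_div {d : ℝ} (hd : 0 < d) :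
    Summable fun n : ℕ => Real.exp (-(n : ℝ) / d) := by
  have h : -d⁻¹ < 0 := by simpa using hd
  refine (Real.summable_exp_nat_mul_iff.mpr h).congr fun n => ?_
  congr 1
  ring

lemma natCast_le_rpow {p : ℝ} (hp : 1 ≤ p) (n : ℕ) : (n : ℝ) ≤ (n : ℝ) ^ p := by
  rcases n.eq_zero_or_pos with rfl | hn
  · simpa using Real.rpow_nonneg le_rfl p
  · exact Real.self_le_rpow_of_one_le (by exact_mod_cast hn) hp

/-- If half of the decay of `f` absorbs `exp (x n)` up to a factor `exp K`, then the exponential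
series with coefficients `f n` is bounded by a multiple of `exp K`. -/
lemma abs_tsum_mul_exp_le {α : ℝ} (hα : 1 ≤ α) {f : ℝ → ℝ} {C₀ c₁ : ℝ} (hC₀ : 0 ≤ C₀)
    (hc₁ : 0 < c₁) (hdecay : ∀ r ≥ (0 : ℝ), |f r| ≤ C₀ * Real.exp (-(r ^ α) / c₁)) {x K : ℝ}
    (hK : ∀ n : ℕ, x * n ≤ (2 * c₁)⁻¹ * (n : ℝ) ^ α + K) :
    |∑' n : ℕ, f n * Real.exp (x * n)| ≤
      C₀ * (∑' n : ℕ, Real.exp (-(n : ℝ) / (2 * c₁))) * Real.exp K := by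
  have hs := ((summable_exp_neg_natCast_div (by positivity : 0 < 2 * c₁)).hasSum.mul_left
    C₀).mul_right (Real.exp K)
  rw [← Real.norm_eq_abs]
  refine tsum_of_norm_bounded hs fun n => ?_
  rw [Real.norm_eq_abs, abs_mul, Real.abs_exp]
  calc |f n| * Real.exp (x * n)
      ≤ C₀ * Real.exp (-((n : ℝ) ^ α) / c₁) * Real.exp (x * n) := by
        gcongr
        exact hdecay n n.cast_nonneg
    _ ≤ C₀ * Real.exp (-(n : ℝ) / (2 * c₁)) * Real.exp K := by
        rw [mul_assoc, mul_assoc, ← Real.exp_add, ← Real.exp_add]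
        refine mul_le_mul_of_nonneg_left (Real.exp_le_exp.mpr ?_) hC₀
        have hpow : (2 * c₁)⁻¹ * (n : ℝ) ≤ (2 * c₁)⁻¹ * (n : ℝ) ^ α := by
          gcongr
          exact natCast_le_rpow hα n
        have hhalf : -((n : ℝ) ^ α) / c₁ = -(2 * ((2 * c₁)⁻¹ * (n : ℝ) ^ α)) := by field_simp
        have hlin : -(n : ℝ) / (2 * c₁) = -((2 * c₁)⁻¹ * (n : ℝ)) := by ring
        linarith [hK n]

/-- If `f` is measurable with `|f(r)| ≤ C₀ exp(−r^α/c₁)` (`α > 1`), then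
`g(x) = Σ_n f(n) e^{xn}` is bounded for `x ≤ 0` and satisfies
`|g(x)| ≤ C exp(c x^{α/(α−1)})` for `x > 0`. -/
theorem superexp_series_growth (α : ℝ) (hα : 1 < α) (f : ℝ → ℝ) (hf : Measurable f)
    (C₀ c₁ : ℝ) (hC₀ : 0 < C₀) (hc₁ : 0 < c₁)
    (hdecay : ∀ r ≥ (0:ℝ), |f r| ≤ C₀ * Real.exp (-(r ^ α) / c₁))
    (g : ℝ → ℝ) (hg : ∀ x : ℝ, g x = ∑' n : ℕ, f n * Real.exp (x * n)) :
    (∃ B : ℝ, ∀ x ≤ (0:ℝ), |g x| ≤ B) ∧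
    (∃ C > (0:ℝ), ∃ c > (0:ℝ), ∀ x > (0:ℝ), |g x| ≤ C * Real.exp (c * x ^ (α / (α - 1)))) := by
  have hα₁ := hα.le
  set S : ℝ := ∑' n : ℕ, Real.exp (-(n : ℝ) / (2 * c₁))
  have hS_pos : 0 < S := (summable_exp_neg_natCast_div (by positivity)).tsum_pos
    (fun n => (Real.exp_pos _).le) 0 (Real.exp_pos _)
  refine ⟨⟨C₀ * S * Real.exp 0, fun x hx => ?_⟩, C₀ * S, by positivity, ?_⟩
  · rw [hg]
    refine abs_tsum_mul_exp_le hα₁ hC₀.le hc₁ hdecay fun n => ?_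
    have hneg : x * n ≤ 0 := mul_nonpos_of_nonpos_of_nonneg hx n.cast_nonneg
    have hpos : 0 ≤ (2 * c₁)⁻¹ * (n : ℝ) ^ α := by positivity
    linarith
  · obtain ⟨c, hc, hyoung⟩ :=
      exists_mul_le_weighted_rpow_add hα (by positivity : 0 < (2 * c₁)⁻¹)
    refine ⟨c, hc, fun x hx => ?_⟩
    rw [hg]
    exact abs_tsum_mul_exp_le hα₁ hC₀.le hc₁ hdecay fun n => hyoung x hx.le n n.cast_nonneg
end
end

section
/- Let Π be an entire function with no zeros in ℂ such that |Π(z)| ≤ C·exp(C·|z|^ρ) for all z ∈ ℂ, for some constants C, ρ > 0. If for every x ∈ ℝ one has Π(x + iy) → 1 as y → +∞, then Π(z) = 1 for all z ∈ ℂ. -/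
open MeasureTheory Real Filter Set

noncomputable section

/-- A zero-free entire function has an entire logarithm. -/
theorem exists_differentiable_exp_eq {F : ℂ → ℂ} (hF : Differentiable ℂ F)
    (hz : ∀ z : ℂ, F z ≠ 0) :
    ∃ g : ℂ → ℂ, Differentiable ℂ g ∧ ∀ z, F z = Complex.exp (g z) := by
  have hF' : Differentiable ℂ (deriv F) :=
    ((hF.contDiff (n := 2)).differentiable_deriv_two)
  have hd : Differentiable ℂ (fun z => deriv F z / F z) := hF'.div hF hz
  obtain ⟨g, hg0, hg⟩ := hd.isExactOn_univ.with_val_at 0 (Complex.log (F 0))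
  have hg' : ∀ z, HasDerivAt g (deriv F z / F z) z := fun z => hg z (mem_univ z)
  refine ⟨g, fun z => (hg' z).differentiableAt, fun z => ?_⟩
  have hq : ∀ w, HasDerivAt (fun w => F w * Complex.exp (-g w)) 0 w := fun w => by
    refine ((hF w).hasDerivAt.mul (hg' w).neg.cexp).congr_deriv ?_
    field_simp [hz w]
    simp
  have hconst := is_const_of_deriv_eq_zero (fun w => (hq w).differentiableAt)
    (fun w => (hq w).deriv) z 0
  simp only [hg0, Complex.exp_neg, Complex.exp_log (hz 0), mul_inv_cancel₀ (hz 0)] at hconst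
  rwa [mul_inv_eq_one₀ (Complex.exp_ne_zero _)] at hconst

/-- Extended Liouville theorem: an entire function of polynomial growth is a polynomial. -/
theorem exists_polynomial_of_norm_le_mul_pow {f : ℂ → ℂ} (hf : Differentiable ℂ f) {B : ℝ}
    {n : ℕ} (hB : ∀ z : ℂ, 1 ≤ ‖z‖ → ‖f z‖ ≤ B * ‖z‖ ^ n) :
    ∃ P : Polynomial ℂ, ∀ z, f z = P.eval z := by
  have hzero : ∀ m, n < m → iteratedDeriv m f 0 = 0 := by
    intro m hm
    have hbound : ∀ R : ℝ, 1 ≤ R → ‖iteratedDeriv m f 0‖ ≤ m.factorial * B * R⁻¹ := by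
      intro R hR
      have hR0 : 0 < R := by linarith
      have hB0 : 0 ≤ B := by
        have := (norm_nonneg _).trans (hB 1 (by simp))
        simpa using this
      refine (Complex.norm_iteratedDeriv_le_of_forall_mem_sphere_norm_le m hR0
        hf.diffContOnCl (C := B * R ^ n) ?_).trans ?_
      · intro z hz
        rw [mem_sphere_zero_iff_norm] at hz
        simpa [hz] using hB z (by rw [hz]; exact hR)
      · rw [div_le_iff₀ (by positivity)]
        have hle : R ^ n ≤ R⁻¹ * R ^ m := by
          rw [inv_mul_eq_div, le_div_iff₀ hR0, ← pow_succ]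
          exact pow_le_pow_right₀ hR hm
        calc (m.factorial : ℝ) * (B * R ^ n) = m.factorial * B * R ^ n := by ring
          _ ≤ m.factorial * B * (R⁻¹ * R ^ m) := by gcongr
          _ = _ := by ring
    have hlim : Tendsto (fun R : ℝ => m.factorial * B * R⁻¹) atTop (nhds 0) := by
      simpa using tendsto_inv_atTop_zero.const_mul ((m.factorial : ℝ) * B)
    exact norm_le_zero_iff.mp <| ge_of_tendsto hlim <|
      (eventually_ge_atTop 1).mono hbound
  refine ⟨∑ k ∈ Finset.range (n + 1),
    Polynomial.C ((k.factorial : ℂ)⁻¹ * iteratedDeriv k f 0) * Polynomial.X ^ k, fun z => ?_⟩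
  rw [← Complex.taylorSeries_eq_of_entire' 0 z hf, tsum_eq_sum (s := Finset.range (n + 1))]
  · simp [Polynomial.eval_finsetSum]
  · intro k hk
    rw [hzero k (by simpa using hk)]
    simp

/-- An entire function whose real part has polynomial growth has itself polynomial growth. -/
theorem norm_le_mul_pow_of_re_le {g : ℂ → ℂ} (hg : Differentiable ℂ g) {A : ℝ} (hA : 0 < A)
    {n : ℕ} (hre : ∀ z : ℂ, ∀ R : ℝ, 1 ≤ R → ‖z‖ ≤ R → (g z).re ≤ A * R ^ n) (z : ℂ)
    (hz : 1 ≤ ‖z‖) : ‖g z‖ ≤ (2 * (A * 2 ^ n) + 3 * ‖g 0‖) * ‖z‖ ^ n := by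
  have hz0 : 0 < ‖z‖ := by linarith
  have hbc := Complex.borelCaratheodory (M := A * (2 * ‖z‖) ^ n) (R := 2 * ‖z‖) (z := z)
    (by positivity) hg.differentiableOn
    (fun w hw => hre w _ (by linarith) (mem_ball_zero_iff.mp hw).le) (by positivity)
    (mem_ball_zero_iff.mpr (by linarith))
  have h1 : 2 * (A * (2 * ‖z‖) ^ n) * ‖z‖ / (2 * ‖z‖ - ‖z‖) +
      ‖g 0‖ * (2 * ‖z‖ + ‖z‖) / (2 * ‖z‖ - ‖z‖) =
      2 * (A * 2 ^ n) * ‖z‖ ^ n + 3 * ‖g 0‖ := by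
    have : 2 * ‖z‖ - ‖z‖ = ‖z‖ := by ring
    rw [this, mul_pow]
    field_simp
    ring
  have h2 : 3 * ‖g 0‖ ≤ 3 * ‖g 0‖ * ‖z‖ ^ n :=
    le_mul_of_one_le_right (by positivity) (one_le_pow₀ hz)
  rw [h1] at hbc
  linarith

/-- A complex polynomial whose real part tends to `0` along the positive real axis has
vanishing real part on the whole real axis. -/
theorem re_eval_eq_zero_of_tendsto {Q : Polynomial ℂ}
    (hQ : Tendsto (fun y : ℝ => (Q.eval (y : ℂ)).re) atTop (nhds 0)) (y : ℝ) :
    (Q.eval (y : ℂ)).re = 0 := by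
  set S : Polynomial ℂ := Q + Q.map (starRingEnd ℂ) with hS
  have heval : ∀ t : ℝ, S.eval (t : ℂ) = ((2 * (Q.eval (t : ℂ)).re : ℝ) : ℂ) := by
    intro t
    have hconj : (Q.map (starRingEnd ℂ)).eval (t : ℂ) = starRingEnd ℂ (Q.eval (t : ℂ)) := by
      conv_lhs => rw [← Complex.conj_ofReal t]
      exact Polynomial.eval_map_apply _ _
    rw [hS, Polynomial.eval_add, hconj, Complex.add_conj]
  have hlim : Tendsto (fun t : ℝ => ‖S.eval (t : ℂ)‖) atTop (nhds 0) := by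
    have := ((hQ.const_mul 2).norm)
    simpa [heval] using this
  have hdeg : S.degree ≤ 0 := by
    by_contra! h
    refine not_tendsto_nhds_of_tendsto_atTop (S.tendsto_norm_atTop h ?_) 0 hlim
    simpa using tendsto_abs_atTop_atTop
  have hconst := Polynomial.eq_C_of_degree_le_zero hdeg
  have h0 : ‖S.coeff 0‖ = 0 := by
    rw [hconst] at hlim
    simp only [Polynomial.eval_C] at hlim
    exact tendsto_nhds_unique tendsto_const_nhds hlim
  have hy := heval y
  rw [hconst, Polynomial.eval_C, norm_eq_zero.mp h0] at hy
  have := Complex.ofReal_eq_zero.mp hy.symm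
  linarith

/-- An entire zero-free function of finite order tending to `1` along every vertical line
`x + iy`, `y → +∞`, is identically `1`. -/
theorem zero_free_finite_order_normalized (F : ℂ → ℂ)
    (hF : Differentiable ℂ F) (hz : ∀ z : ℂ, F z ≠ 0)
    (C ρ : ℝ) (hC : 0 < C) (hρ : 0 < ρ)
    (hgrowth : ∀ z : ℂ, ‖F z‖ ≤ C * Real.exp (C * ‖z‖ ^ ρ))
    (hlim : ∀ x : ℝ, Tendsto (fun y : ℝ => F (x + Complex.I * y)) atTop (nhds 1)) :
    ∀ z : ℂ, F z = 1 := by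
  obtain ⟨g, hg, hFg⟩ := exists_differentiable_exp_eq hF hz
  have hnorm : ∀ z, ‖F z‖ = Real.exp (g z).re := fun z => by rw [hFg, Complex.norm_exp]
  obtain ⟨n, hn⟩ := exists_nat_ge ρ
  have hre : ∀ z : ℂ, ∀ R : ℝ, 1 ≤ R → ‖z‖ ≤ R → (g z).re ≤ (|Real.log C| + C) * R ^ n := by
    intro z R hR hzR
    have h1 : (g z).re ≤ Real.log C + C * ‖z‖ ^ ρ := by
      rw [← Real.exp_le_exp, Real.exp_add, Real.exp_log hC, ← hnorm]
      exact hgrowth z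
    have h2 : ‖z‖ ^ ρ ≤ R ^ n := by
      rw [← Real.rpow_natCast]
      exact (Real.rpow_le_rpow (norm_nonneg z) hzR hρ.le).trans
        (Real.rpow_le_rpow_of_exponent_le hR hn)
    have h3 : |Real.log C| ≤ |Real.log C| * R ^ n :=
      le_mul_of_one_le_right (abs_nonneg _) (one_le_pow₀ hR)
    have h4 : C * ‖z‖ ^ ρ ≤ C * R ^ n := by gcongr
    linarith [le_abs_self (Real.log C)]
  obtain ⟨P, hP⟩ := exists_polynomial_of_norm_le_mul_pow hg
    (norm_le_mul_pow_of_re_le hg (by positivity) hre)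
  have hvert : ∀ x y : ℝ, (g (x + Complex.I * y)).re = 0 := by
    intro x y
    set Q : Polynomial ℂ :=
      P.comp (Polynomial.C (x : ℂ) + Polynomial.C Complex.I * Polynomial.X) with hQ
    have hQg : ∀ t : ℝ, Q.eval (t : ℂ) = g (x + Complex.I * t) := fun t => by simp [hQ, hP]
    rw [← hQg]
    refine re_eval_eq_zero_of_tendsto ?_ y
    have hlog := (hlim x).norm.log (by simp)
    simpa [hnorm, hQg] using hlog
  have hone : ∀ z, ‖F z‖ = 1 := fun z => by
    have := hvert z.re z.im
    rw [mul_comm Complex.I, Complex.re_add_im] at this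
    rw [hnorm, this, Real.exp_zero]
  have hbdd : Bornology.IsBounded (range F) :=
    isBounded_iff_forall_norm_le.mpr ⟨1, by rintro _ ⟨z, rfl⟩; exact (hone z).le⟩
  intro z
  refine tendsto_nhds_unique ?_ (hlim 0)
  exact tendsto_const_nhds.congr fun y => hF.apply_eq_apply_of_bounded hbdd _ _
end
end

section
/- Let Π be an entire function that is bounded on the half-plane {z ∈ ℂ : Im z ≥ 1} and such that for every δ > 0 there is a constant C_δ with |Π(z)| ≤ C_δ·(1 + |z|) for all z with Im z ≥ −δ. Then for all δ > 0 and β > 0 there is a constant C with |Π(z)| ≤ C·(1 + |z|^β) for all z with Im z ≥ −δ. -/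
open MeasureTheory Real Filter Set

noncomputable section

lemma one_le_norm_sub_two {w : ℂ} (hw : w.re ≤ 1) : 1 ≤ ‖w - 2‖ := by
  have h := Complex.abs_re_le_norm (w - 2)
  have h2 : (w - 2).re = w.re - 2 := by simp
  rw [h2] at h
  have := neg_le_abs (w.re - 2)
  linarith

lemma one_add_rpow_le {r β : ℝ} (hr : 0 ≤ r) (hβ : 0 < β) :
    (1 + r) ^ β ≤ 2 ^ β * (1 + r ^ β) := by
  have hrβ : 0 ≤ r ^ β := rpow_nonneg hr β
  rcases le_total r 1 with h | h
  · calc (1 + r) ^ β ≤ 2 ^ β := by gcongr; linarith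
      _ ≤ 2 ^ β * (1 + r ^ β) := le_mul_of_one_le_right (by positivity) (by linarith)
  · calc (1 + r) ^ β ≤ (2 * r) ^ β := by gcongr; linarith
      _ = 2 ^ β * r ^ β := mul_rpow (by norm_num) hr
      _ ≤ 2 ^ β * (1 + r ^ β) := by gcongr; linarith

/-- Three-lines interpolation between a constant bound on `{Im z = 1}` and a linear bound on the
strip `{-D ≤ Im z ≤ 1}`. -/
lemma norm_le_of_linear_growth_strip {F : ℂ → ℂ} (hF : Differentiable ℂ F) {M C D : ℝ}
    (hC : 0 ≤ C) (hD : 0 < D) (hM : ∀ z : ℂ, z.im = 1 → ‖F z‖ ≤ M)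
    (hlin : ∀ z : ℂ, -D ≤ z.im → ‖F z‖ ≤ C * (1 + ‖z‖)) {z : ℂ}
    (hz : -D ≤ z.im) (hz1 : z.im ≤ 1) :
    ‖F z‖ ≤ (2 - z.im) * ((4 * C * (1 + ‖z‖)) ^ (1 - (z.im + D) / (1 + D)) *
      M ^ ((z.im + D) / (1 + D))) := by
  set g : ℂ → ℂ := fun w => F (z.re + Complex.I * w) / (w - 2) with hg
  have him (w : ℂ) : ((z.re : ℂ) + Complex.I * w).im = w.re := by simp
  have hbound (w : ℂ) (hl : -D ≤ w.re) (hu : w.re ≤ 1) : ‖g w‖ ≤ 4 * C * (1 + ‖z‖) := by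
    have h1 := one_le_norm_sub_two hu
    have hζ : ‖(z.re : ℂ) + Complex.I * w‖ ≤ ‖z‖ + (‖w - 2‖ + 2) := by
      refine (norm_add_le _ _).trans (add_le_add ?_ ?_)
      · simpa using Complex.abs_re_le_norm z
      · simpa using norm_add_le (w - 2) 2
    rw [hg, norm_div, div_le_iff₀ (by linarith)]
    refine (hlin _ (by rwa [him])).trans ?_
    have hprod := mul_le_mul_of_nonneg_left h1 (norm_nonneg z)
    calc C * (1 + ‖(z.re : ℂ) + Complex.I * w‖)
        ≤ C * (4 * (1 + ‖z‖) * ‖w - 2‖) := by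
          gcongr
          nlinarith [norm_nonneg z]
      _ = 4 * C * (1 + ‖z‖) * ‖w - 2‖ := by ring
  have hd : DiffContOnCl ℂ g (Complex.HadamardThreeLines.verticalStrip (-D) 1) := by
    refine DifferentiableOn.diffContOnCl fun w hw => ?_
    rw [Complex.HadamardThreeLines.verticalStrip, Complex.closure_preimage_re,
      closure_Ioo (by linarith)] at hw
    have hne : w - 2 ≠ 0 := norm_pos_iff.1 (by linarith [one_le_norm_sub_two hw.2])
    have hnum : DifferentiableAt ℂ (fun w : ℂ => F (z.re + Complex.I * w)) w := by fun_prop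
    have hden : DifferentiableAt ℂ (fun w : ℂ => w - 2) w := by fun_prop
    exact (hnum.div hden hne).differentiableWithinAt
  have key := Complex.HadamardThreeLines.norm_le_interp_of_mem_verticalClosedStrip'
    (f := g) (z := (z.im : ℂ)) (a := 4 * C * (1 + ‖z‖)) (b := M) (l := -D) (u := 1)
    (by linarith) ⟨by simpa using hz, by simpa using hz1⟩ hd
    ⟨4 * C * (1 + ‖z‖), by rintro _ ⟨w, hw, rfl⟩; exact hbound w hw.1 hw.2⟩
    (fun w hw => hbound w (le_of_eq hw.symm) (by rw [hw]; linarith))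
    (fun w hw => by
      rw [hg, norm_div]
      refine (div_le_self (norm_nonneg _) (one_le_norm_sub_two (le_of_eq hw))).trans ?_
      exact hM _ (by rw [him]; exact hw))
  have hgz : ‖g z.im‖ = ‖F z‖ / (2 - z.im) := by
    have h1 : (z.re : ℂ) + Complex.I * z.im = z := by
      rw [mul_comm]; exact Complex.re_add_im z
    have h2 : ‖(z.im : ℂ) - 2‖ = 2 - z.im := by
      rw [show (z.im : ℂ) - 2 = ((z.im - 2 : ℝ) : ℂ) by push_cast; ring, Complex.norm_real,
        Real.norm_eq_abs, abs_of_neg (by linarith)]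
      ring
    simp only [hg]
    rw [norm_div, h1, h2]
  rw [hgz, div_le_iff₀ (by linarith), Complex.ofReal_re, sub_neg_eq_add, sub_neg_eq_add,
    mul_comm] at key
  exact key

/-- Hadamard three-lines improvement: an entire function bounded on `{Im z ≥ 1}` with linear
growth on every half-plane `{Im z ≥ −δ}` in fact grows slower than `1 + |z|^β` on every such
half-plane, for every `β > 0`. -/
theorem linear_growth_improves_to_beta (F : ℂ → ℂ) (hF : Differentiable ℂ F)
    (hbdd : ∃ M : ℝ, ∀ z : ℂ, 1 ≤ z.im → ‖F z‖ ≤ M)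
    (hlin : ∀ δ > (0:ℝ), ∃ C : ℝ, ∀ z : ℂ, -δ ≤ z.im → ‖F z‖ ≤ C * (1 + ‖z‖)) :
    ∀ δ > (0:ℝ), ∀ β > (0:ℝ), ∃ C : ℝ, ∀ z : ℂ, -δ ≤ z.im → ‖F z‖ ≤ C * (1 + ‖z‖ ^ β) := by
  intro δ hδ β hβ
  obtain ⟨M, hM, hM1⟩ : ∃ M : ℝ, (∀ z : ℂ, 1 ≤ z.im → ‖F z‖ ≤ M) ∧ 1 ≤ M := by
    obtain ⟨M, hM⟩ := hbdd
    exact ⟨max M 1, fun z hz => (hM z hz).trans (le_max_left _ _), le_max_right _ _⟩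
  set D : ℝ := δ + (1 + δ) / β with hDdef
  have hδD : δ ≤ D := le_add_of_nonneg_right (by positivity)
  have hD : 0 < D := hδ.trans_le hδD
  obtain ⟨C, hC, hC1⟩ : ∃ C : ℝ, (∀ z : ℂ, -D ≤ z.im → ‖F z‖ ≤ C * (1 + ‖z‖)) ∧ 1 ≤ C := by
    obtain ⟨C, hC⟩ := hlin D hD
    exact ⟨max C 1, fun z hz => (hC z hz).trans (by gcongr; exact le_max_left _ _),
      le_max_right _ _⟩
  have hCβ : 0 ≤ (2 + δ) * ((4 * C) ^ β * 2 ^ β * M) := by positivity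
  refine ⟨(2 + δ) * ((4 * C) ^ β * 2 ^ β * M) + M, fun z hz => ?_⟩
  have hzβ : 0 ≤ ‖z‖ ^ β := rpow_nonneg (norm_nonneg z) β
  rcases le_total 1 z.im with h1 | h1
  · refine (hM z h1).trans ?_
    nlinarith
  have hexp : 1 - (z.im + D) / (1 + D) ≤ β := by
    have hβD : β * D = β * δ + (1 + δ) := by rw [hDdef]; field_simp
    rw [sub_le_comm, le_div_iff₀ (by linarith)]
    nlinarith [mul_pos hβ hδ]
  have hθ : (z.im + D) / (1 + D) ≤ 1 := (div_le_one (by linarith)).2 (by linarith)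
  have ha : 1 ≤ 4 * C * (1 + ‖z‖) := by nlinarith [norm_nonneg z]
  calc ‖F z‖ ≤ (2 - z.im) * ((4 * C * (1 + ‖z‖)) ^ (1 - (z.im + D) / (1 + D)) *
        M ^ ((z.im + D) / (1 + D))) :=
        norm_le_of_linear_growth_strip hF (by linarith) hD (fun w hw => hM w hw.ge) hC
          (by linarith) h1
    _ ≤ (2 + δ) * ((4 * C * (1 + ‖z‖)) ^ β * M) := by
        gcongr
        · linarith
        · exact rpow_le_self_of_one_le hM1 hθ
    _ = (2 + δ) * ((4 * C) ^ β * (1 + ‖z‖) ^ β * M) := by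
        rw [mul_rpow (by positivity) (by positivity)]
    _ ≤ (2 + δ) * ((4 * C) ^ β * (2 ^ β * (1 + ‖z‖ ^ β)) * M) := by
        gcongr
        exact one_add_rpow_le (norm_nonneg z) hβ
    _ = (2 + δ) * ((4 * C) ^ β * 2 ^ β * M) * (1 + ‖z‖ ^ β) := by ring
    _ ≤ ((2 + δ) * ((4 * C) ^ β * 2 ^ β * M) + M) * (1 + ‖z‖ ^ β) := by
        gcongr
        linarith
end
end

section
/- Let (α_n)_{n≥0} be a sequence of complex numbers with |α_n| < 1 for all n, and define polynomials by Φ₀(z) = Φ*₀(z) = 1, Φ_{n+1}(z) = z·Φ_n(z) − conj(α_n)·Φ*_n(z), Φ*_{n+1}(z) = Φ*_n(z) − α_n·z·Φ_n(z). Then: (i) for every n ≥ 0 and every z ∈ ℂ with |z| ≥ 1, |Φ_n(z)| ≤ |z|^n·∏_{k=0}^{n−1}(1 + |α_k|); (ii) if Σ_{n≥0} |α_n|·R^n < ∞ for every R > 0, then the sequence (Φ*_n) converges uniformly on compact subsets of ℂ to an entire function L satisfying |L(z) − 1| ≤ (∏_{k≥0}(1 + |α_k|))·Σ_{n≥0}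 |α_n|·|z|^{n+1} for all |z| ≥ 1. -/
open Filter Set

noncomputable section

/-- On the disc of radius `r ≥ 1`, both solutions of the Szegő recurrence are bounded by
`r ^ n * ∏ k < n, (1 + ‖α k‖)`. -/
lemma szego_norm_le (α : ℕ → ℂ) (Φ Φs : ℕ → ℂ → ℂ)
    (h0 : ∀ z, Φ 0 z = 1) (h0s : ∀ z, Φs 0 z = 1)
    (hrec : ∀ n z, Φ (n + 1) z = z * Φ n z - (starRingEnd ℂ) (α n) * Φs n z)
    (hrecs : ∀ n z, Φs (n + 1) z = Φs n z - α n * z * Φ n z)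
    {r : ℝ} {z : ℂ} (hr : 1 ≤ r) (hz : ‖z‖ ≤ r) (n : ℕ) :
    ‖Φ n z‖ ≤ r ^ n * ∏ k ∈ Finset.range n, (1 + ‖α k‖) ∧
      ‖Φs n z‖ ≤ r ^ n * ∏ k ∈ Finset.range n, (1 + ‖α k‖) := by
  induction n with
  | zero => simp [h0, h0s]
  | succ n ih =>
    obtain ⟨h, hs⟩ := ih
    have hr0 : 0 ≤ r := zero_le_one.trans hr
    rw [Finset.prod_range_succ, hrec, hrecs, pow_succ]
    set P := ∏ k ∈ Finset.range n, (1 + ‖α k‖)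
    have hB : 0 ≤ r ^ n * P := (norm_nonneg _).trans h
    constructor
    · calc ‖z * Φ n z - (starRingEnd ℂ) (α n) * Φs n z‖
          ≤ ‖z‖ * ‖Φ n z‖ + ‖α n‖ * ‖Φs n z‖ := by
            simpa using norm_sub_le (z * Φ n z) ((starRingEnd ℂ) (α n) * Φs n z)
        _ ≤ r * (r ^ n * P) + ‖α n‖ * (r * (r ^ n * P)) := by
            gcongr
            exact hs.trans (le_mul_of_one_le_left hB hr)
        _ = r ^ n * r * (P * (1 + ‖α n‖)) := by ring
    · calc ‖Φs n z - α n * z * Φ n z‖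
          ≤ ‖Φs n z‖ + ‖α n‖ * ‖z‖ * ‖Φ n z‖ := by
            simpa using norm_sub_le (Φs n z) (α n * z * Φ n z)
        _ ≤ r * (r ^ n * P) + ‖α n‖ * r * (r ^ n * P) := by
            gcongr
            exact hs.trans (le_mul_of_one_le_left hB hr)
        _ = r ^ n * r * (P * (1 + ‖α n‖)) := by ring

lemma szego_differentiable (α : ℕ → ℂ) (Φ Φs : ℕ → ℂ → ℂ)
    (h0 : ∀ z, Φ 0 z = 1) (h0s : ∀ z, Φs 0 z = 1)
    (hrec : ∀ n z, Φ (n + 1) z = z * Φ n z - (starRingEnd ℂ) (α n) * Φs n z)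
    (hrecs : ∀ n z, Φs (n + 1) z = Φs n z - α n * z * Φ n z) (n : ℕ) :
    Differentiable ℂ (Φ n) ∧ Differentiable ℂ (Φs n) := by
  induction n with
  | zero =>
    rw [funext h0, funext h0s]
    exact ⟨differentiable_const _, differentiable_const _⟩
  | succ n ih =>
    obtain ⟨h, hs⟩ := ih
    rw [funext (hrec n), funext (hrecs n)]
    constructor <;> fun_prop

lemma prod_one_add_norm_le_tprod {E : Type*} [SeminormedAddGroup E] {a : ℕ → E}
    (ha : Summable fun n => ‖a n‖) (n : ℕ) :
    ∏ k ∈ Finset.range n, (1 + ‖a k‖) ≤ ∏' k, (1 + ‖a k‖) := by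
  have hm : Multipliable fun k => 1 + ‖a k‖ :=
    multipliable_one_add_of_summable (by simpa using ha)
  refine Monotone.ge_of_tendsto (monotone_nat_of_le_succ fun m => ?_) hm.hasProd.tendsto_prod_nat n
  rw [Finset.prod_range_succ]
  exact le_mul_of_one_le_right (Finset.prod_nonneg fun k _ => by positivity)
    (by linarith [norm_nonneg (a m)])

/-- Szegő recurrence bounds: (i) `|Φ_n(z)| ≤ |z|^n ∏_{k<n}(1+|α_k|)` for `|z| ≥ 1`;
(ii) if `Σ |α_n| R^n < ∞` for all `R > 0` then `Φ*_n` converges locally uniformly to an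
entire function `L` with `|L(z) − 1| ≤ (∏_{k}(1+|α_k|)) Σ_n |α_n| |z|^{n+1}` for `|z| ≥ 1`. -/
theorem szego_recurrence_bounds (α : ℕ → ℂ) (hα : ∀ n, ‖α n‖ < 1)
    (Φ Φs : ℕ → ℂ → ℂ)
    (h0 : ∀ z, Φ 0 z = 1) (h0s : ∀ z, Φs 0 z = 1)
    (hrec : ∀ n z, Φ (n + 1) z = z * Φ n z - (starRingEnd ℂ) (α n) * Φs n z)
    (hrecs : ∀ n z, Φs (n + 1) z = Φs n z - α n * z * Φ n z) :
    (∀ n : ℕ, ∀ z : ℂ, 1 ≤ ‖z‖ →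
      ‖Φ n z‖ ≤ ‖z‖ ^ n * ∏ k ∈ Finset.range n, (1 + ‖α k‖)) ∧
    ((∀ R > (0:ℝ), Summable fun n : ℕ => ‖α n‖ * R ^ n) →
      ∃ L : ℂ → ℂ,
        TendstoLocallyUniformly (fun n (z : ℂ) => Φs n z) L atTop ∧
        Differentiable ℂ L ∧
        ∀ z : ℂ, 1 ≤ ‖z‖ →
          ‖L z - 1‖ ≤ (∏' k : ℕ, (1 + ‖α k‖)) * ∑' n : ℕ, ‖α n‖ * ‖z‖ ^ (n + 1)) := by
  refine ⟨fun n z hz => (szego_norm_le α Φ Φs h0 h0s hrec hrecs hz le_rfl n).1, fun hsum => ?_⟩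
  have hs1 : Summable fun n => ‖α n‖ := by simpa using hsum 1 one_pos
  set C := ∏' k : ℕ, (1 + ‖α k‖)
  have hterm : ∀ {r : ℝ} {z : ℂ}, 1 ≤ r → ‖z‖ ≤ r → ∀ k,
      ‖α k * z * Φ k z‖ ≤ C * (‖α k‖ * r ^ (k + 1)) := by
    intro r z hr hz k
    have hr0 : 0 ≤ r := zero_le_one.trans hr
    have hΦ : ‖Φ k z‖ ≤ r ^ k * C :=
      (szego_norm_le α Φ Φs h0 h0s hrec hrecs hr hz k).1.trans
        (mul_le_mul_of_nonneg_left (prod_one_add_norm_le_tprod hs1 k) (by positivity))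
    calc ‖α k * z * Φ k z‖ = ‖α k‖ * ‖z‖ * ‖Φ k z‖ := by simp
      _ ≤ ‖α k‖ * r * (r ^ k * C) := by gcongr
      _ = C * (‖α k‖ * r ^ (k + 1)) := by ring
  have hsumR : ∀ {r : ℝ}, 1 ≤ r → Summable fun n => ‖α n‖ * r ^ (n + 1) := by
    intro r hr
    refine ((hsum r (zero_lt_one.trans_le hr)).mul_right r).congr fun n => ?_
    ring
  have hpartial : ∀ n z, Φs n z = 1 - ∑ k ∈ Finset.range n, α k * z * Φ k z := by
    intro n z
    induction n with
    | zero => simp [h0s]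
    | succ n ih => rw [hrecs, ih, Finset.sum_range_succ]; ring
  have hlim : TendstoLocallyUniformly (fun n (z : ℂ) => Φs n z)
      (fun z => 1 - ∑' k, α k * z * Φ k z) atTop := by
    rw [tendstoLocallyUniformly_iff_forall_isCompact]
    intro K hK
    obtain ⟨R, hR⟩ := hK.isBounded.exists_norm_le
    have h := tendstoUniformlyOn_tsum_nat ((hsumR (le_max_right R 1)).mul_left C)
      (s := K) (f := fun k z => α k * z * Φ k z)
      fun k z hz => hterm (le_max_right R 1) ((hR z hz).trans (le_max_left R 1)) k
    rw [Metric.tendstoUniformlyOn_iff] at h ⊢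
    intro ε hε
    filter_upwards [h ε hε] with n hn z hz
    simpa only [hpartial, dist_sub_left] using hn z hz
  refine ⟨_, hlim, ?_, fun z hz => ?_⟩
  · rw [← differentiableOn_univ]
    exact (tendstoLocallyUniformlyOn_univ.2 hlim).differentiableOn
      (Eventually.of_forall fun n =>
        (szego_differentiable α Φ Φs h0 h0s hrec hrecs n).2.differentiableOn) isOpen_univ
  · have hb := tsum_of_norm_bounded ((hsumR hz).hasSum.mul_left C) (hterm hz le_rfl)
    simpa using hb
end
end
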